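/- For every α ∈ (0,1), the map P ↦ I^{(1)}_α(P,W) is quasi-concave on the probability simplex, i.e., I^{(1)}_α(λP+(1−λ)Q, W) ≥ min{I^{(1)}_α(P,W), I^{(1)}_α(Q,W)} for all probability vectors P, Q on {1,…,n} and all λ ∈ [0,1]. For every α ∈ (1,∞), the map P ↦ I^{(1)}_α(P,W) is concave on the probability simplex. -/

import Mathlib

open Matrix
open scoped ComplexOrder

/-- Real power of a (hermitian) matrix via the continuous functional calculus. -/
noncomputable def mpow {ι : Type*} [Fintype ι] [DecidableEq ι]
    (A : Matrix ι ι ℂ) (r : ℝ) : Matrix ι ι ℂ :=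
  cfc (fun x : ℝ => x ^ r) A

/-- Logarithm of a (hermitian) matrix via the continuous functional calculus. -/
noncomputable def mlog {ι : Type*} [Fintype ι] [DecidableEq ι]
    (A : Matrix ι ι ℂ) : Matrix ι ι ℂ :=
  cfc Real.log A

/-- Real part of the trace. -/
noncomputable def trR {ι : Type*} [Fintype ι] (A : Matrix ι ι ℂ) : ℝ :=
  (Matrix.trace A).re

/-- Positive definite density matrices. -/
def Dens (d : ℕ) : Type :=
  {σ : Matrix (Fin d) (Fin d) ℂ // σ.PosDef ∧ σ.trace = 1}

/-- Petz Rényi information of order `α ≠ 1`. -/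
noncomputable def renyiInfo {d n : ℕ} (α : ℝ) (W : Fin n → Matrix (Fin d) (Fin d) ℂ)
    (P : Fin n → ℝ) : ℝ :=
  ⨅ σ : Dens d, (1 / (α - 1)) *
    Real.log (∑ i, P i * trR (mpow (W i) α * mpow σ.1 (1 - α)))

namespace Matrix

open scoped MatrixOrder

variable {ι : Type*} [Fintype ι]

lemma trR_mul_nonneg {A B : Matrix ι ι ℂ} (hA : A.PosSemidef) (hB : B.PosSemidef) :
    0 ≤ trR (A * B) := by
  classical
  obtain ⟨C, rfl⟩ := CStarAlgebra.nonneg_iff_eq_star_mul_self.mp hB.nonneg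
  rw [trR, ← Matrix.mul_assoc, trace_mul_comm, ← Matrix.mul_assoc]
  exact (Complex.le_def.mp (hA.mul_mul_conjTranspose_same C).trace_nonneg).1

lemma trR_mul_pos [DecidableEq ι] [Nonempty ι] {A B : Matrix ι ι ℂ} (hA : A.PosDef)
    (hB : B.PosDef) : 0 < trR (A * B) := by
  set C := CFC.sqrt B
  have hC : C.PosDef := (isStrictlyPositive_iff_posDef.mpr hB).sqrt.posDef
  have hCC : C * C = B := CFC.sqrt_mul_sqrt_self B hB.posSemidef.nonneg
  rw [trR, ← hCC, ← Matrix.mul_assoc, trace_mul_comm, ← Matrix.mul_assoc]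
  have h := hA.mul_mul_conjTranspose_same (vecMul_injective_of_isUnit hC.isUnit)
  rw [hC.1.eq] at h
  exact (Complex.lt_def.mp h.trace_pos).1

lemma trR_mul_mono_right {A B C : Matrix ι ι ℂ} (hA : A.PosSemidef) (h : B ≤ C) :
    trR (A * B) ≤ trR (A * C) := by
  have := trR_mul_nonneg hA (le_iff.mp h)
  rw [Matrix.mul_sub, trR, trace_sub, Complex.sub_re] at this
  exact sub_nonneg.mp this

variable [DecidableEq ι]

lemma PosDef.mpow {A : Matrix ι ι ℂ} (hA : A.PosDef) (r : ℝ) : (mpow A r).PosDef := by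
  refine isStrictlyPositive_iff_posDef.mp
    ((cfc_isStrictlyPositive_iff _ _ (finite_real_spectrum.continuousOn _) hA.1).mpr ?_)
  exact fun _ hx =>
    Real.rpow_pos_of_pos ((isStrictlyPositive_iff_posDef.mpr hA).spectrum_pos hx) _

lemma PosDef.mem_Ioc_of_mem_spectrum {A : Matrix ι ι ℂ} (hA : A.PosDef) (htr : A.trace = 1)
    {x : ℝ} (hx : x ∈ spectrum ℝ A) : x ∈ Set.Ioc (0 : ℝ) 1 := by
  rw [hA.1.spectrum_real_eq_range_eigenvalues] at hx
  obtain ⟨i, rfl⟩ := hx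
  refine ⟨hA.eigenvalues_pos i, ?_⟩
  have h := congrArg Complex.re (htr.symm.trans hA.1.trace_eq_sum_eigenvalues)
  have h1 : (1 : ℝ) = ∑ j, hA.1.eigenvalues j := by simpa using h
  rw [h1]
  exact Finset.single_le_sum (fun j _ => (hA.eigenvalues_pos j).le) (Finset.mem_univ i)

lemma mpow_le_one {A : Matrix ι ι ℂ} (hA : A.PosDef) (htr : A.trace = 1) {r : ℝ}
    (hr : 0 ≤ r) : mpow A r ≤ 1 :=
  cfc_le_one _ _ fun _ hx =>
    have h := hA.mem_Ioc_of_mem_spectrum htr hx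
    Real.rpow_le_one h.1.le h.2 hr

lemma one_le_mpow {A : Matrix ι ι ℂ} (hA : A.PosDef) (htr : A.trace = 1) {r : ℝ}
    (hr : r ≤ 0) : 1 ≤ mpow A r :=
  one_le_cfc _ _ (fun _ hx =>
    have h := hA.mem_Ioc_of_mem_spectrum htr hx
    Real.one_le_rpow_of_pos_of_le_one_of_nonpos h.1 h.2 hr)
    (finite_real_spectrum.continuousOn _)
    hA.1

end Matrix

lemma nonempty_dens {d : ℕ} (hd : 0 < d) : Nonempty (Dens d) := by
  have hd' : (0 : ℂ) < d := by exact_mod_cast hd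
  refine ⟨⟨(d : ℂ)⁻¹ • 1, PosDef.one.smul (inv_pos.mpr hd'), ?_⟩⟩
  simp [trace_smul, hd'.ne']

/-- The quantity inside the logarithm defining the Petz Rényi information. -/
noncomputable def petzSum {d n : ℕ} (α : ℝ) (W : Fin n → Matrix (Fin d) (Fin d) ℂ)
    (P : Fin n → ℝ) (σ : Dens d) : ℝ :=
  ∑ i, P i * trR (mpow (W i) α * mpow σ.1 (1 - α))

section petzSum

variable {d n : ℕ} {α : ℝ} {W : Fin n → Matrix (Fin d) (Fin d) ℂ} {P : Fin n → ℝ}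

lemma sum_mul_pos_of_sum_eq_one {ι : Type*} [Fintype ι] {p c : ι → ℝ} (hp : ∀ i, 0 ≤ p i)
    (hp1 : ∑ i, p i = 1) (hc : ∀ i, 0 < c i) : 0 < ∑ i, p i * c i := by
  obtain ⟨i, -, hi⟩ := Finset.exists_ne_zero_of_sum_ne_zero (hp1.trans_ne one_ne_zero)
  exact Finset.sum_pos' (fun j _ => mul_nonneg (hp j) (hc j).le)
    ⟨i, Finset.mem_univ i, mul_pos ((hp i).lt_of_ne' hi) (hc i)⟩

lemma petzSum_pos (hd : 0 < d) (hW : ∀ i, (W i).PosDef) (hP : ∀ i, 0 ≤ P i)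
    (hP1 : ∑ i, P i = 1) (σ : Dens d) : 0 < petzSum α W P σ := by
  have : Nonempty (Fin d) := ⟨⟨0, hd⟩⟩
  exact sum_mul_pos_of_sum_eq_one hP hP1 fun i => trR_mul_pos ((hW i).mpow α) (σ.2.1.mpow _)

lemma petzSum_mix (P Q : Fin n → ℝ) (l : ℝ) (σ : Dens d) :
    petzSum α W (fun i => l * P i + (1 - l) * Q i) σ =
      l * petzSum α W P σ + (1 - l) * petzSum α W Q σ := by
  simp only [petzSum, Finset.mul_sum, ← Finset.sum_add_distrib]
  exact Finset.sum_congr rfl fun i _ => by ring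

lemma bddBelow_range_log_petzSum (hd : 0 < d) (hW : ∀ i, (W i).PosDef) (hP : ∀ i, 0 ≤ P i)
    (hP1 : ∑ i, P i = 1) :
    BddBelow (Set.range fun σ : Dens d => 1 / (α - 1) * Real.log (petzSum α W P σ)) := by
  have : Nonempty (Fin d) := ⟨⟨0, hd⟩⟩
  refine ⟨1 / (α - 1) * Real.log (∑ i, P i * trR (mpow (W i) α * 1)), ?_⟩
  rintro _ ⟨σ, rfl⟩
  rcases le_total α 1 with hα | hα
  · refine mul_le_mul_of_nonpos_left (Real.log_le_log (petzSum_pos hd hW hP hP1 σ) ?_)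
      (one_div_nonpos.mpr (sub_nonpos.mpr hα))
    exact Finset.sum_le_sum fun i _ => mul_le_mul_of_nonneg_left (trR_mul_mono_right
      ((hW i).mpow α).posSemidef (mpow_le_one σ.2.1 σ.2.2 (sub_nonneg.mpr hα))) (hP i)
  · refine mul_le_mul_of_nonneg_left (Real.log_le_log (sum_mul_pos_of_sum_eq_one hP hP1
      fun i => trR_mul_pos ((hW i).mpow α) PosDef.one) ?_)
      (one_div_nonneg.mpr (sub_nonneg.mpr hα))
    exact Finset.sum_le_sum fun i _ => mul_le_mul_of_nonneg_left (trR_mul_mono_right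
      ((hW i).mpow α).posSemidef (one_le_mpow σ.2.1 σ.2.2 (sub_nonpos.mpr hα))) (hP i)

lemma renyiInfo_le (hd : 0 < d) (hW : ∀ i, (W i).PosDef) (hP : ∀ i, 0 ≤ P i)
    (hP1 : ∑ i, P i = 1) (σ : Dens d) :
    renyiInfo α W P ≤ 1 / (α - 1) * Real.log (petzSum α W P σ) :=
  ciInf_le (bddBelow_range_log_petzSum hd hW hP hP1) σ

end petzSum

/-- `P ↦ I^{(1)}_α(P,W)` is quasi-concave on the probability simplex
for `α ∈ (0,1)` and concave for `α ∈ (1,∞)`. -/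
theorem renyiInfo_quasiConcave_and_concave_in_prior {d n : ℕ} (hd : 0 < d) (hn : 0 < n)
    (W : Fin n → Matrix (Fin d) (Fin d) ℂ)
    (hW : ∀ i, (W i).PosDef ∧ (W i).trace = 1)
    (α : ℝ) :
    ∀ P Q : Fin n → ℝ,
      (∀ i, 0 ≤ P i) → ∑ i, P i = 1 →
      (∀ i, 0 ≤ Q i) → ∑ i, Q i = 1 →
      ∀ l : ℝ, l ∈ Set.Icc (0 : ℝ) 1 →
        (α ∈ Set.Ioo (0 : ℝ) 1 →
          min (renyiInfo α W P) (renyiInfo α W Q) ≤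
            renyiInfo α W (fun i => l * P i + (1 - l) * Q i)) ∧
        (1 < α →
          l * renyiInfo α W P + (1 - l) * renyiInfo α W Q ≤
            renyiInfo α W (fun i => l * P i + (1 - l) * Q i)) := by
  intro P Q hP hP1 hQ hQ1 l ⟨hl0, hl1⟩
  have := nonempty_dens hd
  have hl1' : 0 ≤ 1 - l := sub_nonneg.mpr hl1
  have hW' i := (hW i).1
  refine ⟨fun hα => le_ciInf fun σ => ?_, fun hα => le_ciInf fun σ => ?_⟩ <;>
  · change _ ≤ 1 / (α - 1) * Real.log (petzSum α W _ σ)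
    rw [petzSum_mix]
    have hPσ := petzSum_pos (α := α) hd hW' hP hP1 σ
    have hQσ := petzSum_pos (α := α) hd hW' hQ hQ1 σ
    have hIP := renyiInfo_le (α := α) hd hW' hP hP1 σ
    have hIQ := renyiInfo_le (α := α) hd hW' hQ hQ1 σ
    first
    | have hc : 0 ≤ 1 / (α - 1) := one_div_nonneg.mpr (sub_nonneg.mpr hα.le)
      have hlog := strictConcaveOn_log_Ioi.concaveOn.2 hPσ hQσ hl0 hl1' (by ring)
      simp only [smul_eq_mul] at hlog
      calc _ ≤ _ := add_le_add (mul_le_mul_of_nonneg_left hIP hl0)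
            (mul_le_mul_of_nonneg_left hIQ hl1')
        _ = 1 / (α - 1) * (l * Real.log (petzSum α W P σ) +
            (1 - l) * Real.log (petzSum α W Q σ)) := by ring
        _ ≤ _ := mul_le_mul_of_nonneg_left hlog hc
    | have hc : 1 / (α - 1) ≤ 0 := one_div_nonpos.mpr (sub_nonpos.mpr hα.2.le)
      have hmix : 0 < l * petzSum α W P σ + (1 - l) * petzSum α W Q σ := by
        rw [← petzSum_mix]
        exact petzSum_pos hd hW' (fun i => by have := hP i; have := hQ i; positivity)
          (by simp [Finset.sum_add_distrib, ← Finset.mul_sum, hP1, hQ1]) σ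
      rcases le_total (petzSum α W P σ) (petzSum α W Q σ) with h | h
      · exact (min_le_right _ _).trans (hIQ.trans (mul_le_mul_of_nonpos_left
          (Real.log_le_log hmix (by nlinarith)) hc))
      · exact (min_le_left _ _).trans (hIP.trans (mul_le_mul_of_nonpos_left
          (Real.log_le_log hmix (by nlinarith)) hc))
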